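/- Let m ≥ 3 and n > i_2 > i_3 > … > i_{m−1} > 0 be integers, and let (B_1, B_2, …, B_{m−1}, B_m) be an ordered decomposition of {1,…,N}. Then in F = ℚ(z_1,…,z_N) one has s_{((n−m+1)^{|B_1|}, (i_2−m+2)^{|B_2|}, …, (i_{m−1}+1)^{|B_{m−1}|})}(z_1,…,z_N) = Σ over all ordered decompositions (C_1, C_mid, C_m) of {1,…,N} with |C_1| = |B_1|, |C_mid| = |B_2|+…+|B_{m−1}|, |C_m| = |B_m| of [ (1 − z_{C_mid}/z_{C_1})·(1 − z_{C_m}/z_{C_1})·(1 − z_{C_m}/z_{C_mid}) ]^{-1} · z_{C_1}^{ n+1−m} · z_{C_mid}^{-1} · s_{((i_2−m+3)^{|B_2|}, (i_3−m+4)^{|B_3|}, …, i_{m−1}^{|B_{m−1}|})}(z_{C_mid}), where on the left the partition is padded with |B_m| zeros to length N. -/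

import Mathlib

open scoped BigOperators

noncomputable section

/-- `F N` is the field `ℚ(z_1, …, z_N)` of rational functions in `N` variables. -/
abbrev F (N : ℕ) := FractionRing (MvPolynomial (Fin N) ℚ)

/-- The variable `z_a` viewed inside `F N`. -/
noncomputable def z {N : ℕ} (a : Fin N) : F N :=
  algebraMap (MvPolynomial (Fin N) ℚ) (F N) (MvPolynomial.X a)

/-- `z_A^p := ∏_{a ∈ A} z_a^p`. -/
noncomputable def zpowProd {N : ℕ} (A : Finset (Fin N)) (p : ℤ) : F N :=
  ∏ a ∈ A, z a ^ p

/-- `1 − z_A/z_B := ∏_{a∈A} ∏_{b∈B} (1 − z_a/z_b)`. -/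
noncomputable def oneSub {N : ℕ} (A B : Finset (Fin N)) : F N :=
  ∏ a ∈ A, ∏ b ∈ B, (1 - z a / z b)

/-- `z_A − z_B := ∏_{a∈A} ∏_{b∈B} (z_a − z_b)`. -/
noncomputable def zsub {N : ℕ} (A B : Finset (Fin N)) : F N :=
  ∏ a ∈ A, ∏ b ∈ B, (z a - z b)

/-- Read an exponent sequence off a list, padding with `0`. -/
def padded (L : List ℤ) : ℕ → ℤ := fun t => L.getD t 0

/-- The Schur polynomial (bialternant form) associated with the index set
`A ⊆ {1,…,N}` (with its increasing enumeration) and the exponent sequence `lam`. -/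
noncomputable def schur {N : ℕ} (A : Finset (Fin N)) (lam : ℕ → ℤ) : F N :=
  Matrix.det (Matrix.of fun i j : Fin A.card =>
      z ((A.orderIsoOfFin rfl i : Fin N)) ^ (lam j + (A.card : ℤ) - 1 - (j : ℤ)))
    / Matrix.det (Matrix.of fun i j : Fin A.card =>
      z ((A.orderIsoOfFin rfl i : Fin N)) ^ ((A.card : ℤ) - 1 - (j : ℤ)))

theorem z_ne_zero {N : ℕ} (a : Fin N) : (z a : F N) ≠ 0 :=
  (map_ne_zero_iff _ (IsFractionRing.injective (MvPolynomial (Fin N) ℚ) (F N))).2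
    (MvPolynomial.X_ne_zero a)

theorem z_injective {N : ℕ} : Function.Injective (z : Fin N → F N) :=
  (IsFractionRing.injective (MvPolynomial (Fin N) ℚ) (F N)).comp
    (MvPolynomial.X_injective (σ := Fin N) (R := ℚ))

section Alternant

variable {K : Type*} [Field K]

/-- The alternant `det (x_i ^ (lam_j + n - 1 - j))`. -/
noncomputable def alternant {n : ℕ} (x : Fin n → K) (lam : ℕ → ℤ) : K :=
  Matrix.det (Matrix.of fun i j : Fin n => x i ^ (lam j + (n : ℤ) - 1 - (j : ℤ)))

theorem alternant_comp_perm {n : ℕ} (x : Fin n → K) (lam : ℕ → ℤ) (σ : Equiv.Perm (Fin n)) :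
    alternant (x ∘ σ) lam = Equiv.Perm.sign σ * alternant x lam :=
  Matrix.det_permute σ (Matrix.of fun i j : Fin n => x i ^ (lam j + (n : ℤ) - 1 - (j : ℤ)))

theorem alternant_comp_cycleRange_symm {n : ℕ} (x : Fin (n + 1) → K) (lam : ℕ → ℤ)
    (i : Fin (n + 1)) :
    alternant (x ∘ i.cycleRange.symm) lam = (-1) ^ (i : ℕ) * alternant x lam := by
  simp [alternant_comp_perm, Fin.sign_cycleRange]

theorem alternant_zero_eq_prod {n : ℕ} (x : Fin n → K) :
    alternant x (fun _ => 0) = ∏ i : Fin n, ∏ j ∈ Finset.Ioi i, (x i - x j) := by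
  have h : (Matrix.projVandermonde (fun _ => 1) x).det =
      ∏ i : Fin n, ∏ j ∈ Finset.Ioi i, (x i - x j) := by
    simp [Matrix.det_projVandermonde]
  rw [← h, alternant]
  congr 1
  ext i j
  have hj : ((0 : ℤ) + n - 1 - j) = ((j.rev : ℕ) : ℤ) := by
    rw [Fin.val_rev]; have := j.isLt; omega
  simp only [Matrix.of_apply, Matrix.projVandermonde_apply, one_pow, one_mul, hj, zpow_natCast]

theorem alternant_zero_ne_zero {n : ℕ} {x : Fin n → K} (hx : Function.Injective x) :
    alternant x (fun _ => 0) ≠ 0 := by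
  rw [alternant_zero_eq_prod]
  refine Finset.prod_ne_zero_iff.2 fun i _ => Finset.prod_ne_zero_iff.2 fun j hj => ?_
  exact sub_ne_zero.2 (hx.ne (Finset.mem_Ioi.1 hj).ne)

theorem alternant_zero_succ {n : ℕ} (x : Fin (n + 1) → K) :
    alternant x (fun _ => 0) =
      (∏ k : Fin n, (x 0 - x k.succ)) * alternant (x ∘ Fin.succ) (fun _ => 0) := by
  simp [alternant_zero_eq_prod, Fin.prod_univ_succ, Fin.prod_Ioi_succ]

theorem alternant_zero_succAbove {n : ℕ} (x : Fin (n + 1) → K) (i : Fin (n + 1)) :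
    (-1) ^ (i : ℕ) * alternant x (fun _ => 0) =
      (∏ k : Fin n, (x i - x (i.succAbove k))) *
        alternant (x ∘ i.succAbove) (fun _ => 0) := by
  rw [← alternant_comp_cycleRange_symm, alternant_zero_succ]
  simp [Function.comp_def]

theorem alternant_succ {n : ℕ} (x : Fin (n + 1) → K) (lam : ℕ → ℤ) :
    alternant x lam = ∑ i : Fin (n + 1), (-1) ^ (i : ℕ) * x i ^ (lam 0 + n) *
      alternant (x ∘ i.succAbove) (fun t => lam (t + 1)) := by
  rw [alternant, Matrix.det_succ_column_zero]
  refine Finset.sum_congr rfl fun i _ => ?_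
  congr 2
  · simp only [Matrix.of_apply, Fin.val_zero]
    congr 1
    push_cast
    ring
  · ext k l
    simp only [Matrix.submatrix_apply, Matrix.of_apply, Function.comp_apply, Fin.val_succ]
    congr 1
    push_cast
    ring

theorem alternant_div_succ {n : ℕ} {x : Fin (n + 1) → K} (hx : Function.Injective x)
    (h0 : ∀ i, x i ≠ 0) (lam : ℕ → ℤ) :
    alternant x lam / alternant x (fun _ => 0) =
      ∑ i : Fin (n + 1), x i ^ lam 0 * (∏ k : Fin n, (1 - x (i.succAbove k) / x i))⁻¹ *
        (alternant (x ∘ i.succAbove) (fun t => lam (t + 1)) /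
          alternant (x ∘ i.succAbove) (fun _ => 0)) := by
  rw [alternant_succ x lam, Finset.sum_div]
  refine Finset.sum_congr rfl fun i _ => ?_
  have hV := alternant_zero_ne_zero hx
  have hV' := alternant_zero_ne_zero (hx.comp (Fin.succAbove_right_injective (p := i)))
  have hs : ((-1 : K) ^ (i : ℕ)) * (-1) ^ (i : ℕ) = 1 := by
    rw [← mul_pow]; simp
  have hrec := alternant_zero_succAbove x i
  have hprod : ∏ k : Fin n, (x i - x (i.succAbove k)) =
      x i ^ n * ∏ k : Fin n, (1 - x (i.succAbove k) / x i) := by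
    rw [← Fin.prod_const, ← Finset.prod_mul_distrib]
    refine Finset.prod_congr rfl fun k _ => ?_
    have := h0 i
    field_simp
  have hP : ∏ k : Fin n, (1 - x (i.succAbove k) / x i) ≠ 0 := by
    refine Finset.prod_ne_zero_iff.2 fun k _ => ?_
    rw [sub_ne_zero, ne_comm, Ne, div_eq_one_iff_eq (h0 i)]
    exact hx.ne (Fin.succAbove_ne i k)
  rw [hprod] at hrec
  rw [zpow_add₀ (h0 i), zpow_natCast]
  rw [div_eq_iff hV]
  field_simp
  linear_combination x i ^ lam 0 * alternant (x ∘ i.succAbove) (fun t => lam (t + 1)) *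
    (alternant x (fun _ => 0) * hs - (-1 : K) ^ (i : ℕ) * hrec)

theorem alternant_add_const {n : ℕ} {x : Fin n → K} (h0 : ∀ i, x i ≠ 0) (lam : ℕ → ℤ) (c : ℤ) :
    alternant x (fun t => lam t + c) = (∏ i, x i ^ c) * alternant x lam := by
  rw [alternant, alternant, ← Matrix.det_mul_column]
  congr 1
  ext i j
  simp only [Matrix.of_apply]
  rw [← zpow_add₀ (h0 i)]
  congr 1
  ring

end Alternant

theorem schur_eq_alternant {N k : ℕ} (A : Finset (Fin N)) (hA : A.card = k) (lam : ℕ → ℤ) :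
    schur A lam = alternant (fun t => z (A.orderEmbOfFin hA t)) lam /
      alternant (fun t => z (A.orderEmbOfFin hA t)) (fun _ => 0) := by
  subst hA
  simp only [schur, alternant, zero_add, Finset.orderEmbOfFin, Finset.coe_orderIsoOfFin_apply]

theorem schur_congr {N : ℕ} (A : Finset (Fin N)) {lam mu : ℕ → ℤ}
    (h : ∀ t < A.card, lam t = mu t) : schur A lam = schur A mu := by
  unfold schur
  congr 3
  ext i j
  rw [h j j.isLt]

theorem schur_zero {N : ℕ} (A : Finset (Fin N)) : schur A (fun _ => 0) = 1 := by
  rw [schur_eq_alternant A rfl]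
  exact div_self (alternant_zero_ne_zero (z_injective.comp (A.orderEmbOfFin rfl).injective))

theorem schur_add_const {N : ℕ} (A : Finset (Fin N)) (lam : ℕ → ℤ) (c : ℤ) :
    schur A (fun t => lam t + c) = zpowProd A c * schur A lam := by
  rw [schur_eq_alternant A rfl, schur_eq_alternant A rfl,
    alternant_add_const (fun _ => z_ne_zero _), mul_div_assoc]
  congr 1
  rw [zpowProd, ← Finset.prod_coe_sort A, ← (A.orderIsoOfFin rfl).toEquiv.prod_comp]
  rfl

theorem schur_const {N : ℕ} (A : Finset (Fin N)) (c : ℤ) :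
    schur A (fun _ => c) = zpowProd A c := by
  simpa [schur_zero] using schur_add_const A (fun _ => 0) c

theorem schur_eq_sum_erase {N : ℕ} {A : Finset (Fin N)} (hA : A.Nonempty) (lam : ℕ → ℤ) :
    schur A lam = ∑ a ∈ A, z a ^ lam 0 * (oneSub (A.erase a) {a})⁻¹ *
      schur (A.erase a) (fun t => lam (t + 1)) := by
  obtain ⟨k, hk⟩ : ∃ k, A.card = k + 1 := ⟨A.card - 1, by have := hA.card_pos; omega⟩
  rw [schur_eq_alternant A hk, alternant_div_succ
    (x := fun t => z (A.orderEmbOfFin hk t))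
    (z_injective.comp (A.orderEmbOfFin hk).injective) (fun _ => z_ne_zero _)]
  rw [← Finset.sum_coe_sort A, ← (A.orderIsoOfFin hk).toEquiv.sum_comp]
  refine Finset.sum_congr rfl fun i _ => ?_
  have hi : ((A.orderIsoOfFin hk).toEquiv i : Fin N) = A.orderEmbOfFin hk i := rfl
  rw [hi]
  have hcard : (A.erase (A.orderEmbOfFin hk i)).card = k := by
    rw [Finset.card_erase_of_mem (Finset.orderEmbOfFin_mem A hk i)]; omega
  have henum : (fun t => A.orderEmbOfFin hk (i.succAbove t)) =
      (A.erase (A.orderEmbOfFin hk i)).orderEmbOfFin hcard := by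
    refine Finset.orderEmbOfFin_unique hcard (fun t => ?_)
      ((A.orderEmbOfFin hk).strictMono.comp (Fin.strictMono_succAbove i))
    exact Finset.mem_erase.2 ⟨(A.orderEmbOfFin hk).injective.ne (Fin.succAbove_ne i t),
      Finset.orderEmbOfFin_mem A hk _⟩
  have henum' := fun t => congrFun henum t
  rw [schur_eq_alternant _ hcard]
  congr 1
  · congr 2
    rw [oneSub, ← Finset.prod_coe_sort (A.erase (A.orderEmbOfFin hk i)),
      ← ((A.erase (A.orderEmbOfFin hk i)).orderIsoOfFin hcard).toEquiv.prod_comp]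
    refine Finset.prod_congr rfl fun t _ => ?_
    rw [Finset.prod_singleton, henum']
    rfl
  · simp only [Function.comp_def, henum']

theorem oneSub_disjUnion_left {N : ℕ} {A B : Finset (Fin N)} (h : Disjoint A B)
    (C : Finset (Fin N)) : oneSub (A ∪ B) C = oneSub A C * oneSub B C :=
  Finset.prod_union h

theorem oneSub_insert_right {N : ℕ} (A : Finset (Fin N)) {b : Fin N} {B : Finset (Fin N)}
    (h : b ∉ B) : oneSub A (insert b B) = oneSub A {b} * oneSub A B := by
  simp [oneSub, Finset.prod_insert h, Finset.prod_mul_distrib]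

theorem schur_eq_sum_powersetCard {N : ℕ} (p : ℕ) (A : Finset (Fin N)) (hp : p ≤ A.card)
    (lam : ℕ → ℤ) :
    schur A lam = ∑ C ∈ A.powersetCard p, (oneSub (A \ C) C)⁻¹ * schur C lam *
      schur (A \ C) (fun t => lam (p + t)) := by
  induction p generalizing A lam with
  | zero =>
    have h : schur (∅ : Finset (Fin N)) lam = 1 := by simp [schur]
    simp [oneSub, h]
  | succ p ih =>
    rw [schur_eq_sum_erase (Finset.card_pos.1 (by omega))]
    have hl : ∀ a ∈ A, z a ^ lam 0 * (oneSub (A.erase a) {a})⁻¹ *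
        schur (A.erase a) (fun t => lam (t + 1)) =
        ∑ C ∈ (A.erase a).powersetCard p, z a ^ lam 0 * (oneSub (A.erase a) {a})⁻¹ *
          ((oneSub (A.erase a \ C) C)⁻¹ * schur C (fun t => lam (t + 1)) *
            schur (A.erase a \ C) (fun t => lam (p + t + 1))) := fun a ha => by
      rw [ih (A.erase a) (by rw [Finset.card_erase_of_mem ha]; omega), Finset.mul_sum]
    have hr : ∀ C ∈ A.powersetCard (p + 1), (oneSub (A \ C) C)⁻¹ * schur C lam *
        schur (A \ C) (fun t => lam (p + 1 + t)) =
        ∑ a ∈ C, (oneSub (A \ C) C)⁻¹ * (z a ^ lam 0 * (oneSub (C.erase a) {a})⁻¹ *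
          schur (C.erase a) (fun t => lam (t + 1))) *
            schur (A \ C) (fun t => lam (p + 1 + t)) := fun C hC => by
      rw [schur_eq_sum_erase (Finset.card_pos.1 (by rw [(Finset.mem_powersetCard.1 hC).2]; omega)),
        Finset.mul_sum, Finset.sum_mul]
    rw [Finset.sum_congr rfl hl, Finset.sum_congr rfl hr, Finset.sum_sigma', Finset.sum_sigma']
    refine Finset.sum_bij' (fun x _ => ⟨insert x.1 x.2, x.1⟩) (fun y _ => ⟨y.2, y.1.erase y.2⟩)
      ?_ ?_ ?_ ?_ ?_
    · rintro ⟨a, C⟩ h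
      simp only [Finset.mem_sigma, Finset.mem_powersetCard, Finset.subset_erase] at h ⊢
      exact ⟨⟨Finset.insert_subset h.1 h.2.1.1, by
        rw [Finset.card_insert_of_notMem h.2.1.2, h.2.2]⟩, Finset.mem_insert_self _ _⟩
    · rintro ⟨C, a⟩ h
      simp only [Finset.mem_sigma, Finset.mem_powersetCard] at h ⊢
      exact ⟨h.1.1 h.2, Finset.erase_subset_erase _ h.1.1, by
        rw [Finset.card_erase_of_mem h.2, h.1.2]; omega⟩
    · rintro ⟨a, C⟩ h
      simp only [Finset.mem_sigma, Finset.mem_powersetCard, Finset.subset_erase] at h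
      simp [Finset.erase_insert h.2.1.2]
    · rintro ⟨C, a⟩ h
      simp only [Finset.mem_sigma] at h
      simp [Finset.insert_erase h.2]
    · rintro ⟨a, C⟩ h
      simp only [Finset.mem_sigma, Finset.mem_powersetCard, Finset.subset_erase] at h
      obtain ⟨ha, ⟨hCA, haC⟩, -⟩ := h
      have h1 : A.erase a \ C = A \ insert a C := by
        ext b; simp only [Finset.mem_sdiff, Finset.mem_erase, Finset.mem_insert]; tauto
      have h2 : A.erase a = C ∪ A \ insert a C := by
        rw [← h1, Finset.union_sdiff_of_subset (Finset.subset_erase.2 ⟨hCA, haC⟩)]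
      have h3 : Disjoint C (A \ insert a C) :=
        Finset.disjoint_sdiff.mono_left (Finset.subset_insert a C)
      have h4 : (fun t => lam (p + t + 1)) = fun t => lam (p + 1 + t) := by
        funext t; congr 1; ring
      simp only [h1, Finset.erase_insert haC, h4]
      rw [h2, oneSub_disjUnion_left h3, oneSub_insert_right _ haC]
      simp only [mul_inv]
      ring

/-- Splitting off a rectangular first block and a zero last block from a Schur polynomial. -/
theorem schur_univ_eq_sum_triples {N : ℕ} (p k q : ℕ) (hN : p + k + q = N) (lam : ℕ → ℤ) (c : ℤ)
    (hfirst : ∀ t < p, lam t = c) (hlast : ∀ t, p + k ≤ t → lam t = 0)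
    (S : Finset (Finset (Fin N) × Finset (Fin N) × Finset (Fin N)))
    (hS : ∀ P, P ∈ S ↔ P.1.card = p ∧ P.2.1.card = k ∧ P.2.2.card = q ∧ Disjoint P.1 P.2.1 ∧
      Disjoint P.1 P.2.2 ∧ Disjoint P.2.1 P.2.2 ∧ P.1 ∪ P.2.1 ∪ P.2.2 = Finset.univ) :
    schur Finset.univ lam = ∑ P ∈ S,
      (oneSub P.2.1 P.1 * oneSub P.2.2 P.1 * oneSub P.2.2 P.2.1)⁻¹ * zpowProd P.1 c *
        schur P.2.1 (fun t => lam (p + t)) := by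
  rw [schur_eq_sum_powersetCard p Finset.univ (by simp; omega)]
  have hmid : ∀ C ∈ (Finset.univ : Finset (Fin N)).powersetCard p,
      (oneSub (Finset.univ \ C) C)⁻¹ * schur C lam *
        schur (Finset.univ \ C) (fun t => lam (p + t)) =
      ∑ D ∈ (Finset.univ \ C).powersetCard k, (oneSub (Finset.univ \ C) C)⁻¹ * zpowProd C c *
        ((oneSub ((Finset.univ \ C) \ D) D)⁻¹ * schur D (fun t => lam (p + t))) := by
    intro C hC
    have hCp := (Finset.mem_powersetCard.1 hC).2
    rw [schur_congr C (mu := fun _ => c) (fun t ht => hfirst t (hCp ▸ ht)), schur_const,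
      schur_eq_sum_powersetCard k (Finset.univ \ C)
        (by rw [Finset.card_univ_sdiff, Fintype.card_fin]; omega), Finset.mul_sum]
    refine Finset.sum_congr rfl fun D _ => ?_
    rw [schur_congr (_ \ D) (mu := fun _ => 0) (fun t _ => hlast _ (by omega)), schur_zero, mul_one]
  rw [Finset.sum_congr rfl hmid, Finset.sum_sigma']
  refine Finset.sum_bij' (fun x _ => (x.1, x.2, (Finset.univ \ x.1) \ x.2))
    (fun P _ => ⟨P.1, P.2.1⟩) ?_ ?_ ?_ ?_ ?_
  · rintro ⟨C, D⟩ h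
    simp only [Finset.mem_sigma, Finset.mem_powersetCard] at h
    obtain ⟨⟨-, hC⟩, hD, hDk⟩ := h
    refine (hS _).2 ⟨hC, hDk, ?_, (Finset.disjoint_sdiff.mono_right hD),
      Finset.disjoint_sdiff.mono_right Finset.sdiff_subset, Finset.disjoint_sdiff, ?_⟩
    · simp only
      rw [Finset.card_sdiff_of_subset hD, Finset.card_univ_sdiff, Fintype.card_fin]
      omega
    · ext b
      simp only [Finset.mem_union, Finset.mem_sdiff, Finset.mem_univ]
      tauto
  · rintro ⟨C, D, E⟩ h
    obtain ⟨hC, hD, -, hCD, -, -, -⟩ := (hS _).1 h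
    simp only [Finset.mem_sigma, Finset.mem_powersetCard]
    exact ⟨⟨Finset.subset_univ _, hC⟩,
      Finset.subset_sdiff.2 ⟨Finset.subset_univ _, hCD.symm⟩, hD⟩
  · rintro ⟨C, D⟩ _
    rfl
  · rintro ⟨C, D, E⟩ h
    obtain ⟨-, -, -, -, hCE, hDE, hU⟩ := (hS _).1 h
    have : (Finset.univ \ C) \ D = E := by
      simp only at hCE hDE hU
      rw [← hU, sdiff_sdiff_left]
      exact Finset.union_sdiff_cancel_left (Finset.disjoint_union_left.2 ⟨hCE, hDE⟩)
    simp [this]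
  · rintro ⟨C, D⟩ h
    simp only [Finset.mem_sigma, Finset.mem_powersetCard] at h
    have h2 : oneSub (Finset.univ \ C) C =
        oneSub D C * oneSub ((Finset.univ \ C) \ D) C := by
      rw [← oneSub_disjUnion_left Finset.disjoint_sdiff, Finset.union_sdiff_of_subset h.2.1]
    simp only [h2, mul_inv]
    ring

open Classical in
/-- the unified FNR/GM-type identity, with the first block frozen at `n`
and the last block frozen at `0`.  Here `i j` denotes `i_{j+2}` for `j : Fin (m-2)`,
so that `n > i_2 > ⋯ > i_{m-1} > 0`. -/
theorem statement8 (N n m : ℕ) (hm : 3 ≤ m)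
    (i : Fin (m - 2) → ℕ) (hanti : StrictAnti i) (hn : ∀ j, i j < n)
    (hpos : ∀ j, 0 < i j)
    (B : Fin m → Finset (Fin N))
    (hdisj : ∀ j k, j ≠ k → Disjoint (B j) (B k))
    (hcover : Finset.univ.biUnion B = Finset.univ) :
    schur (Finset.univ : Finset (Fin N))
        (padded (List.replicate (B ⟨0, by omega⟩).card ((n : ℤ) - m + 1) ++
          (List.ofFn fun j : Fin (m - 2) =>
            List.replicate (B ⟨(j : ℕ) + 1, by have := j.isLt; omega⟩).card
              ((i j : ℤ) - m + 2 + (j : ℤ))).flatten))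
      = ∑ P ∈ Finset.univ.filter
            (fun P : Finset (Fin N) × Finset (Fin N) × Finset (Fin N) =>
            P.1.card = (B ⟨0, by omega⟩).card ∧
            P.2.1.card = (∑ j : Fin (m - 2),
              (B ⟨(j : ℕ) + 1, by have := j.isLt; omega⟩).card) ∧
            P.2.2.card = (B ⟨m - 1, by omega⟩).card ∧
            Disjoint P.1 P.2.1 ∧ Disjoint P.1 P.2.2 ∧ Disjoint P.2.1 P.2.2 ∧
            P.1 ∪ P.2.1 ∪ P.2.2 = Finset.univ),
          (oneSub P.2.1 P.1 * oneSub P.2.2 P.1 * oneSub P.2.2 P.2.1)⁻¹ *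
            zpowProd P.1 ((n : ℤ) + 1 - m) * zpowProd P.2.1 (-1) *
            schur P.2.1
              (padded (List.ofFn fun j : Fin (m - 2) =>
                List.replicate (B ⟨(j : ℕ) + 1, by have := j.isLt; omega⟩).card
                  ((i j : ℤ) - m + 3 + (j : ℤ))).flatten) := by
  have hcard : (B ⟨0, by omega⟩).card + (∑ j : Fin (m - 2),
      (B ⟨(j : ℕ) + 1, by have := j.isLt; omega⟩).card) + (B ⟨m - 1, by omega⟩).card = N := by
    have h1 : ∑ j, (B j).card = N := by
      rw [← Finset.card_biUnion (fun j _ k _ h => hdisj j k h), hcover]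
      simp
    obtain ⟨r, rfl⟩ : ∃ r, m = r + 2 := ⟨m - 2, by omega⟩
    rw [Fin.sum_univ_succ, Fin.sum_univ_castSucc, ← add_assoc] at h1
    exact h1
  have hlen : ∀ f : Fin (m - 2) → ℤ, ((List.ofFn fun j : Fin (m - 2) =>
      List.replicate (B ⟨(j : ℕ) + 1, by have := j.isLt; omega⟩).card (f j)).flatten).length =
      ∑ j : Fin (m - 2), (B ⟨(j : ℕ) + 1, by have := j.isLt; omega⟩).card := fun f => by
    simp [List.length_flatten, List.map_ofFn, List.sum_ofFn, Function.comp_def]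
  symm
  refine Eq.trans (Finset.sum_congr rfl ?_)
    (schur_univ_eq_sum_triples _ _ _ hcard _ ((n : ℤ) + 1 - m) ?_ ?_ _
      (fun P => by rw [Finset.mem_filter, and_iff_right (Finset.mem_univ P)])).symm
  · intro P hP
    obtain ⟨-, -, hmid, -⟩ := Finset.mem_filter.1 hP
    rw [mul_assoc _ (zpowProd P.2.1 (-1)), ← schur_add_const]
    congr 1
    refine schur_congr _ fun t ht => ?_
    rw [hmid] at ht
    have hmap : (List.ofFn fun j : Fin (m - 2) =>
        List.replicate (B ⟨(j : ℕ) + 1, by have := j.isLt; omega⟩).card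
          ((i j : ℤ) - m + 2 + (j : ℤ))).flatten = ((List.ofFn fun j : Fin (m - 2) =>
        List.replicate (B ⟨(j : ℕ) + 1, by have := j.isLt; omega⟩).card
          ((i j : ℤ) - m + 3 + (j : ℤ))).flatten).map (· + -1) := by
      rw [List.map_flatten, List.map_ofFn]
      congr 2
      funext j
      simp only [Function.comp_apply, List.map_replicate]
      congr 1
      ring
    rw [padded, padded, List.getD_append_right _ _ _ _ (by simp), List.length_replicate,
      Nat.add_sub_cancel_left, hmap,
      List.getD_eq_getElem _ _ (by rw [hlen]; exact ht),
      List.getD_eq_getElem _ _ (by rw [List.length_map, hlen]; exact ht), List.getElem_map]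
  · intro t ht
    rw [padded, List.getD_append _ _ _ _ (by simpa using ht), List.getD_replicate _ ht]
    ring
  · intro t ht
    rw [padded, List.getD_eq_default]
    rw [List.length_append, hlen, List.length_replicate]
    exact ht

end
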